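/- For every positive integer m, the number of partitions of m into parts congruent to 1 or 4 modulo 5 equals the number of partitions of m in which any two consecutive parts differ by at least 2. -/

import Mathlib

namespace RogersRamanujan

/-- The Gaussian binomial coefficient `[n, k]` at `q`, with integer lower index `k`. -/
def gaussBinom {A : Type*} [CommRing A] (q : A) : ℕ → ℤ → A
  | 0, k => if k = 0 then 1 else 0
  | n + 1, k => gaussBinom q n (k - 1) + q ^ k.toNat * gaussBinom q n k

/-- The finite `q`-Pochhammer symbol `(q; q)_n`. -/
def qFactorial {A : Type*} [CommRing A] (q : A) (n : ℕ) : A :=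
  ∏ i ∈ Finset.range n, (1 - q ^ (i + 1))

/-- The summand `(-1) ^ j * q ^ (j * (5 * j + 1) / 2)` of the theta series. -/
def thetaTerm {A : Type*} [CommRing A] (q : A) (j : ℤ) : A :=
  (-1) ^ j.natAbs * q ^ (j * (5 * j + 1) / 2).toNat

/-- The solution of `u (n + 2) = u (n + 1) + q ^ (n + 1) * u n` with `u 0 = u 1 = 1`. -/
def schurPoly {A : Type*} [CommRing A] (q : A) : ℕ → A
  | 0 => 1
  | 1 => 1
  | n + 2 => schurPoly q (n + 1) + q ^ (n + 1) * schurPoly q n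

section CommRing

variable {A B : Type*} [CommRing A] [CommRing B] (f : A →+* B) (q : A)

theorem map_gaussBinom (n : ℕ) (k : ℤ) :
    f (gaussBinom q n k) = gaussBinom (f q) n k := by
  induction n generalizing k with
  | zero => simp only [gaussBinom]; split_ifs <;> simp
  | succ n ih => simp [gaussBinom, ih]

theorem map_thetaTerm (j : ℤ) : f (thetaTerm q j) = thetaTerm (f q) j := by
  simp [thetaTerm]

theorem map_schurPoly (n : ℕ) : f (schurPoly q n) = schurPoly (f q) n := by
  induction n using Nat.twoStepInduction with
  | zero => simp [schurPoly]
  | one => simp [schurPoly]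
  | more n h₀ h₁ => simp [schurPoly, h₀, h₁]

theorem gaussBinom_of_neg (n : ℕ) {k : ℤ} (hk : k < 0) : gaussBinom q n k = 0 := by
  induction n generalizing k with
  | zero => simp [gaussBinom, hk.ne]
  | succ n ih => simp [gaussBinom, ih hk, ih (show k - 1 < 0 by lia)]

theorem gaussBinom_of_lt {n : ℕ} {k : ℤ} (hk : n < k) : gaussBinom q n k = 0 := by
  induction n generalizing k with
  | zero => simp only [gaussBinom]; rw [if_neg]; lia
  | succ n ih =>
    rw [gaussBinom, ih (by push_cast at hk; lia), ih (by push_cast at hk; lia)]; simp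

theorem gaussBinom_zero_right (n : ℕ) : gaussBinom q n 0 = 1 := by
  induction n with
  | zero => simp [gaussBinom]
  | succ n ih => simp [gaussBinom, ih, gaussBinom_of_neg]

theorem gaussBinom_self (n : ℕ) : gaussBinom q n n = 1 := by
  induction n with
  | zero => simp [gaussBinom]
  | succ n ih => simp [gaussBinom, ih, gaussBinom_of_lt]

theorem qFactorial_succ (n : ℕ) :
    qFactorial q (n + 1) = qFactorial q n * (1 - q ^ (n + 1)) :=
  Finset.prod_range_succ _ _

theorem gaussBinom_mul_qFactorial (a b : ℕ) :
    gaussBinom q (a + b) a * (qFactorial q a * qFactorial q b) = qFactorial q (a + b) := by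
  induction h : a + b generalizing a b with
  | zero =>
    obtain ⟨rfl, rfl⟩ : a = 0 ∧ b = 0 := by lia
    simp [gaussBinom, qFactorial]
  | succ n ih =>
    rcases a with _ | a
    · obtain rfl : b = n + 1 := by lia
      have := gaussBinom_zero_right q (n + 1)
      simp_all [qFactorial]
    rcases b with _ | b
    · obtain rfl : a = n := by lia
      rw [gaussBinom_self]
      simp [qFactorial]
    have h₁ := ih a (b + 1) (by lia)
    have h₂ := ih (a + 1) b (by lia)
    have e : ((a + 1 : ℕ) : ℤ) - 1 = a := by push_cast; ring
    rw [gaussBinom, e, Int.toNat_natCast, qFactorial_succ q n]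
    rw [qFactorial_succ] at h₁ h₂ ⊢
    rw [qFactorial_succ]
    obtain rfl : n = a + b + 1 := by lia
    linear_combination (1 - q ^ (a + 1)) * h₁ + q ^ (a + 1) * (1 - q ^ (b + 1)) * h₂

theorem hasFiniteSupport_mul_gaussBinom (n : ℕ) (g : ℤ → A) {φ : ℤ → ℤ}
    (hφ : ∀ k, (φ ⁻¹' {k}).Finite) :
    Function.HasFiniteSupport fun j ↦ g j * gaussBinom q n (φ j) := by
  refine ((Set.finite_Icc (0 : ℤ) n).preimage' (fun k _ ↦ hφ k)).subset fun j hj ↦ ?_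
  by_contra h
  refine hj ?_
  rcases lt_or_ge (φ j) 0 with h₀ | h₀
  · simp [gaussBinom_of_neg q n h₀]
  · have : (n : ℤ) < φ j := by
      by_contra h'
      exact h ⟨h₀, by lia⟩
    simp [gaussBinom_of_lt q this]

theorem hasFiniteSupport_schur (n : ℕ) : Function.HasFiniteSupport fun j : ℤ ↦
    thetaTerm q j * gaussBinom q n (((n : ℤ) - 5 * j) / 2) :=
  hasFiniteSupport_mul_gaussBinom q n (thetaTerm q) (φ := fun j ↦ ((n : ℤ) - 5 * j) / 2) fun c ↦
    (Set.finite_Icc (-|c| - n - 5) (|c| + n + 5)).subset fun j hj ↦ by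
      simp only [Set.mem_preimage, Set.mem_singleton_iff] at hj
      have := le_abs_self c
      have := neg_abs_le c
      exact ⟨by lia, by lia⟩

theorem hasFiniteSupport_tripleProduct (n b : ℕ) : Function.HasFiniteSupport fun j : ℤ ↦
    thetaTerm q j * gaussBinom (q ^ 5) n (b + j) :=
  hasFiniteSupport_mul_gaussBinom (q ^ 5) n (thetaTerm q) (φ := fun j ↦ (b : ℤ) + j) fun c ↦
    (Set.finite_singleton (c - b)).subset fun j hj ↦ by
      simp only [Set.mem_preimage, Set.mem_singleton_iff] at hj ⊢
      lia

end CommRing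

section Field

variable {K : Type*} [Field K] {q : K}

theorem gaussBinom_succ (n : ℕ) (k : ℤ) :
    gaussBinom q (n + 1) k = gaussBinom q n (k - 1) + q ^ k * gaussBinom q n k := by
  rw [gaussBinom]
  rcases lt_or_ge k 0 with hk | hk
  · simp [gaussBinom_of_neg q n hk]
  · lift k to ℕ using hk
    simp

theorem gaussBinom_succ' (hq : q ≠ 0) (n : ℕ) (k : ℤ) :
    gaussBinom q (n + 1) k =
      gaussBinom q n k + q ^ ((n : ℤ) + 1 - k) * gaussBinom q n (k - 1) := by
  induction n generalizing k with
  | zero =>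
    rw [gaussBinom_succ]
    simp only [gaussBinom]
    rcases eq_or_ne k 0 with rfl | h₀
    · simp
    rcases eq_or_ne k 1 with rfl | h₁
    · simp
    · simp [h₀, sub_eq_zero, h₁]
  | succ n ih =>
    have h₃ := ih (k - 1)
    have h₄ := gaussBinom_succ (q := q) n (k - 1)
    rw [gaussBinom_succ (n + 1)]
    have h₁ : q ^ k * q ^ ((n : ℤ) + 1 - k) = q ^ (((n + 1 : ℕ) : ℤ) + 1 - k) * q ^ (k - 1) := by
      rw [← zpow_add₀ hq, ← zpow_add₀ hq]
      congr 1
      push_cast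
      ring
    have h₂ : (n : ℤ) + 1 - (k - 1) = ((n + 1 : ℕ) : ℤ) + 1 - k := by push_cast; ring
    rw [h₂] at h₃
    linear_combination h₃ + q ^ k * ih k - gaussBinom_succ (q := q) n k
      - q ^ (((n + 1 : ℕ) : ℤ) + 1 - k) * h₄ + gaussBinom q n (k - 1) * h₁

theorem thetaTerm_succ (hq : q ≠ 0) (j : ℤ) :
    thetaTerm q (j + 1) = -(thetaTerm q j * q ^ (5 * j + 3)) := by
  have key (j : ℤ) : thetaTerm q j = (-1) ^ j * q ^ (j * (5 * j + 1) / 2) := by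
    have h : 0 ≤ j * (5 * j + 1) / 2 := by
      apply Int.ediv_nonneg _ (by norm_num)
      rcases lt_or_ge j 0 with h | h <;> nlinarith
    rw [thetaTerm, ← zpow_natCast q, Int.toNat_of_nonneg h]
    congr 1
    rcases Int.even_or_odd j with h | h
    · rw [h.neg_one_zpow, (Int.natAbs_even.2 h).neg_one_pow]
    · rw [h.neg_one_zpow, (Int.natAbs_odd.2 h).neg_one_pow]
  have h : (j + 1) * (5 * (j + 1) + 1) / 2 = j * (5 * j + 1) / 2 + (5 * j + 3) := by
    rw [show (j + 1) * (5 * (j + 1) + 1) = j * (5 * j + 1) + (5 * j + 3) * 2 by ring,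
      Int.add_mul_ediv_right _ _ (by norm_num)]
  rw [key, key, h, zpow_add₀ hq, zpow_add₀ (by simp : (-1 : K) ≠ 0), zpow_one]
  ring


theorem schurPoly_residual_even (hq : q ≠ 0) {n : ℕ} {j c : ℤ} (h : (n : ℤ) + 2 - 5 * j = 2 * c) :
    gaussBinom q (n + 2) ((((n + 2 : ℕ) : ℤ) - 5 * j) / 2)
      - gaussBinom q (n + 1) ((((n + 1 : ℕ) : ℤ) - 5 * j) / 2)
      - q ^ (n + 1) * gaussBinom q n (((n : ℤ) - 5 * j) / 2) = q ^ c * gaussBinom q n c := by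
  rw [show (((n + 2 : ℕ) : ℤ) - 5 * j) / 2 = c by lia,
    show (((n + 1 : ℕ) : ℤ) - 5 * j) / 2 = c - 1 by lia,
    show ((n : ℤ) - 5 * j) / 2 = c - 1 by lia, gaussBinom_succ (n + 1), gaussBinom_succ' hq n c]
  have e : q ^ c * q ^ ((n : ℤ) + 1 - c) = q ^ (n + 1) := by
    rw [← zpow_add₀ hq, ← zpow_natCast]
    congr 1
    push_cast
    ring
  linear_combination gaussBinom q n (c - 1) * e

theorem schurPoly_residual_odd (hq : q ≠ 0) {n : ℕ} {j c : ℤ}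
    (h : (n : ℤ) + 2 - 5 * j = 2 * c + 1) :
    gaussBinom q (n + 2) ((((n + 2 : ℕ) : ℤ) - 5 * j) / 2)
      - gaussBinom q (n + 1) ((((n + 1 : ℕ) : ℤ) - 5 * j) / 2)
      - q ^ (n + 1) * gaussBinom q n (((n : ℤ) - 5 * j) / 2) =
      q ^ ((n : ℤ) + 2 - c) * gaussBinom q n (c - 2) := by
  rw [show (((n + 2 : ℕ) : ℤ) - 5 * j) / 2 = c by lia,
    show (((n + 1 : ℕ) : ℤ) - 5 * j) / 2 = c by lia,
    show ((n : ℤ) - 5 * j) / 2 = c - 1 by lia, gaussBinom_succ' hq (n + 1),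
    gaussBinom_succ n (c - 1), show c - 1 - 1 = c - 2 by ring,
    show ((n + 1 : ℕ) : ℤ) + 1 - c = (n : ℤ) + 2 - c by push_cast; ring]
  have e : q ^ ((n : ℤ) + 2 - c) * q ^ (c - 1) = q ^ (n + 1) := by
    rw [← zpow_add₀ hq, ← zpow_natCast]
    congr 1
    push_cast
    ring
  linear_combination gaussBinom q n (c - 1) * e

/-- The involution of `ℤ` pairing each `j` with `n - j` even with `j - 1`. -/
def shiftInvolution (n : ℕ) (j : ℤ) : ℤ := if Even ((n : ℤ) - j) then j - 1 else j + 1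

theorem shiftInvolution_involutive (n : ℕ) : Function.Involutive (shiftInvolution n) := by
  intro j
  simp only [shiftInvolution, Int.even_iff]
  split_ifs <;> lia

/-- Schur's finite form of the sum side, over a field. -/
theorem schurPoly_eq_finsum_of_field [CharZero K] (hq : q ≠ 0) (n : ℕ) :
    schurPoly q n = ∑ᶠ j : ℤ, thetaTerm q j * gaussBinom q n (((n : ℤ) - 5 * j) / 2) := by
  induction n using Nat.twoStepInduction with
  | zero =>
    rw [finsum_eq_single _ 0]
    · simp [schurPoly, thetaTerm, gaussBinom]
    · intro j hj
      rw [gaussBinom, if_neg (by push_cast; lia), mul_zero]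
  | one =>
    rw [finsum_eq_single _ 0]
    · simp [schurPoly, thetaTerm, gaussBinom]
    · intro j hj
      rcases lt_or_ge j 0 with h | h
      · rw [gaussBinom_of_lt q (by push_cast; lia), mul_zero]
      · rw [gaussBinom_of_neg q _ (by push_cast; lia), mul_zero]
  | more n h₀ h₁ =>
    have fs := hasFiniteSupport_schur q
    have fs₀ : Function.HasFiniteSupport fun j ↦
        q ^ (n + 1) * (thetaTerm q j * gaussBinom q n (((n : ℤ) - 5 * j) / 2)) :=
      (fs n).fun_mul_right _
    rw [schurPoly, h₀, h₁, mul_finsum, eq_comm, ← sub_eq_zero, ← sub_sub,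
      ← finsum_sub_distrib (fs _) (fs _), ← finsum_sub_distrib ((fs _).fun_sub (fs _)) fs₀]
    set r : ℤ → K := fun j ↦ _ with hr
    change ∑ᶠ j, r j = 0
    have key (j : ℤ) (h : Even ((n : ℤ) - j)) : r j = - r (j - 1) := by
      obtain ⟨d, hd⟩ := h
      obtain ⟨c, hc⟩ : ∃ c, (n : ℤ) + 2 - 5 * j = 2 * c := ⟨d + 1 - 2 * j, by lia⟩
      have e₁ := schurPoly_residual_even hq hc
      have e₂ := schurPoly_residual_odd (n := n) (j := j - 1) (c := c + 2) hq (by lia)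
      have e₃ := thetaTerm_succ hq (j - 1)
      have e₄ : q ^ (5 * (j - 1) + 3) * q ^ c = q ^ ((n : ℤ) + 2 - (c + 2)) := by
        rw [← zpow_add₀ hq]
        congr 1
        lia
      rw [sub_add_cancel] at e₃
      rw [add_sub_cancel_right] at e₂
      simp only [hr]
      linear_combination thetaTerm q j * e₁ + thetaTerm q (j - 1) * e₂
        + q ^ c * gaussBinom q n c * e₃ - thetaTerm q (j - 1) * gaussBinom q n c * e₄
    have inv (j : ℤ) : r (shiftInvolution n j) = - r j := by
      rw [shiftInvolution]
      split_ifs with h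
      · rw [key j h, neg_neg]
      · rw [key (j + 1) (by rw [Int.even_iff] at *; lia), add_sub_cancel_right]
    have h := finsum_comp_equiv (shiftInvolution_involutive n).toPerm (f := r)
    simp only [Function.Involutive.coe_toPerm, inv, finsum_neg_distrib] at h
    exact self_eq_neg.1 h.symm

/-- A finite form of the Jacobi triple product, over a field. -/
theorem prod_eq_finsum_of_field (hq : q ≠ 0) (a b : ℕ) :
    (∏ k ∈ Finset.range a, (1 - q ^ (5 * k + 3))) * ∏ k ∈ Finset.range b, (1 - q ^ (5 * k + 2)) =
      ∑ᶠ j : ℤ, thetaTerm q j * gaussBinom (q ^ 5) (a + b) (b + j) := by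
  have hq5 : q ^ 5 ≠ 0 := pow_ne_zero _ hq
  have fs := hasFiniteSupport_tripleProduct q
  have hz (k : ℤ) : (q ^ 5) ^ k = q ^ (5 * k) := by
    rw [zpow_mul]; norm_cast
  have shift (F : ℤ → K) (c : K) (d : ℤ) (hF : F.HasFiniteSupport) :
      (∑ᶠ j, F j) * (1 - c) = ∑ᶠ j, (F j - c * F (j + d)) := by
    have hF' : Function.HasFiniteSupport fun j ↦ F (j + d) :=
      hF.preimage (add_left_injective d).injOn
    have e := finsum_comp_equiv (Equiv.addRight d) (f := F)
    simp only [Equiv.coe_addRight] at e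
    rw [finsum_sub_distrib hF (hF'.fun_mul_right _), ← mul_finsum, e]
    ring
  induction a with
  | zero =>
    induction b with
    | zero =>
      rw [finsum_eq_single _ 0]
      · simp [thetaTerm, gaussBinom]
      · intro j hj
        rw [gaussBinom, if_neg (by push_cast; lia), mul_zero]
    | succ b ih =>
      rw [Finset.prod_range_succ, ← mul_assoc, ih, shift _ _ 1 (fs _ _)]
      refine finsum_congr fun j ↦ ?_
      rw [← add_assoc 0 b 1, gaussBinom_succ, hz, thetaTerm_succ hq,
        show ((b + 1 : ℕ) : ℤ) + j - 1 = b + j by push_cast; ring,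
        show ((b + 1 : ℕ) : ℤ) + j = b + (j + 1) by push_cast; ring]
      have e : q ^ (5 * b + 2) * q ^ (5 * j + 3) = q ^ (5 * (b + (j + 1))) := by
        rw [← zpow_natCast, ← zpow_add₀ hq]
        congr 1
        push_cast
        ring
      linear_combination thetaTerm q j * gaussBinom (q ^ 5) (0 + b) (b + (j + 1)) * e
  | succ a ih =>
    rw [Finset.prod_range_succ, mul_right_comm, ih, shift _ _ (-1) (fs _ _)]
    refine finsum_congr fun j ↦ ?_
    have e₁ := thetaTerm_succ hq (j - 1)
    rw [add_right_comm, gaussBinom_succ' hq5, hz, ← sub_eq_add_neg, ← add_sub_assoc]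
    have e : q ^ (5 * (((a + b : ℕ) : ℤ) + 1 - (b + j))) * q ^ (5 * (j - 1) + 3) =
        q ^ (5 * a + 3) := by
      rw [← zpow_natCast, ← zpow_add₀ hq]
      congr 1
      push_cast
      ring
    rw [sub_add_cancel] at e₁
    linear_combination thetaTerm q (j - 1) * gaussBinom (q ^ 5) (a + b) (b + j - 1) * e
      - q ^ (5 * (((a + b : ℕ) : ℤ) + 1 - (b + j))) * gaussBinom (q ^ 5) (a + b) (b + j - 1) * e₁

end Field
section Transfer

open Polynomial

variable {A : Type*} [CommRing A] (q : A)

/-- Schur's finite form of the sum side of the first Rogers-Ramanujan identity. -/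
theorem schurPoly_eq_finsum (n : ℕ) :
    schurPoly q n = ∑ᶠ j : ℤ, thetaTerm q j * gaussBinom q n (((n : ℤ) - 5 * j) / 2) := by
  have h : schurPoly (X : ℤ[X]) n =
      ∑ᶠ j : ℤ, thetaTerm X j * gaussBinom X n (((n : ℤ) - 5 * j) / 2) := by
    apply IsFractionRing.injective ℤ[X] (FractionRing ℤ[X])
    rw [map_finsum _ (hasFiniteSupport_schur _ n), map_schurPoly,
      schurPoly_eq_finsum_of_field (by simp)]
    simp only [map_mul, map_thetaTerm, map_gaussBinom]
  have h' := congrArg (eval₂RingHom (Int.castRingHom A) q) h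
  rw [map_finsum _ (hasFiniteSupport_schur _ n), map_schurPoly] at h'
  simpa only [map_mul, map_thetaTerm, map_gaussBinom, coe_eval₂RingHom, eval₂_X] using h'

/-- A finite form of the Jacobi triple product. -/
theorem prod_eq_finsum (a b : ℕ) :
    (∏ k ∈ Finset.range a, (1 - q ^ (5 * k + 3))) * ∏ k ∈ Finset.range b, (1 - q ^ (5 * k + 2)) =
      ∑ᶠ j : ℤ, thetaTerm q j * gaussBinom (q ^ 5) (a + b) (b + j) := by
  have h : (∏ k ∈ Finset.range a, (1 - (X : ℤ[X]) ^ (5 * k + 3))) *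
      ∏ k ∈ Finset.range b, (1 - X ^ (5 * k + 2)) =
      ∑ᶠ j : ℤ, thetaTerm X j * gaussBinom (X ^ 5) (a + b) (b + j) := by
    apply IsFractionRing.injective ℤ[X] (FractionRing ℤ[X])
    rw [map_finsum _ (hasFiniteSupport_tripleProduct _ _ _)]
    simp only [map_mul, map_prod, map_sub, map_one, map_pow, map_thetaTerm, map_gaussBinom]
    exact prod_eq_finsum_of_field (by simp) a b
  have h' := congrArg (eval₂RingHom (Int.castRingHom A) q) h
  rw [map_finsum _ (hasFiniteSupport_tripleProduct _ _ _)] at h'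
  simpa only [map_mul, map_prod, map_sub, map_one, map_pow, map_thetaTerm, map_gaussBinom,
    coe_eval₂RingHom, eval₂_X] using h'

end Transfer

section Nilpotent

variable {A : Type*} [CommRing A] {q : A} {m : ℕ} (hq : q ^ (m + 1) = 0)
include hq

theorem thetaTerm_eq_zero {j : ℤ} (hj : m < |j|) : thetaTerm q j = 0 := by
  have h : m + 1 ≤ (j * (5 * j + 1) / 2).toNat := by
    suffices (m : ℤ) + 1 ≤ j * (5 * j + 1) / 2 by lia
    rw [Int.le_ediv_iff_mul_le (by norm_num)]
    rcases abs_cases j with ⟨h, h'⟩ | ⟨h, h'⟩ <;> nlinarith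
  rw [thetaTerm, pow_eq_zero_of_le h hq, mul_zero]

theorem isUnit_one_sub_pow (i : ℕ) : IsUnit (1 - q ^ (i + 1)) :=
  IsNilpotent.isUnit_one_sub
    (IsNilpotent.pow_of_pos ⟨m + 1, hq⟩ (Nat.succ_ne_zero i))

theorem isUnit_qFactorial (n : ℕ) : IsUnit (qFactorial q n) :=
  (IsUnit.prod_iff).2 fun i _ ↦ isUnit_one_sub_pow hq i

theorem qFactorial_eq_of_le {n : ℕ} (h : m ≤ n) : qFactorial q n = qFactorial q m := by
  induction n, h using Nat.le_induction with
  | base => rfl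
  | succ n hn ih =>
    rw [qFactorial_succ, ih, pow_eq_zero_of_le (by lia) hq, sub_zero, mul_one]

theorem gaussBinom_mul_qFactorial_eq_one {n : ℕ} {k : ℤ} (h₀ : m ≤ k) (h₁ : m ≤ n - k) :
    gaussBinom q n k * qFactorial q m = 1 := by
  lift k to ℕ using by lia
  obtain ⟨b, rfl⟩ : ∃ b, n = k + b := ⟨n - k, by lia⟩
  have h := gaussBinom_mul_qFactorial q k b
  rw [qFactorial_eq_of_le hq (by lia : m ≤ k), qFactorial_eq_of_le hq (by lia : m ≤ b),
    qFactorial_eq_of_le hq (by lia : m ≤ k + b), ← mul_assoc] at h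
  exact (isUnit_qFactorial hq m).mul_eq_right.1 h

theorem schurPoly_mul_qFactorial {n : ℕ} (hn : 7 * m + 2 ≤ n) :
    schurPoly q n * qFactorial q m = ∑ᶠ j : ℤ, thetaTerm q j := by
  rw [schurPoly_eq_finsum, finsum_mul' _ _ (hasFiniteSupport_schur q n)]
  refine finsum_congr fun j ↦ ?_
  rcases lt_or_ge (m : ℤ) |j| with hj | hj
  · simp [thetaTerm_eq_zero hq hj]
  · rw [abs_le] at hj
    rw [mul_assoc, gaussBinom_mul_qFactorial_eq_one hq (by lia) (by lia), mul_one]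

theorem prod_mul_qFactorial {n : ℕ} (hn : 2 * m ≤ n) :
    (∏ k ∈ Finset.range n, (1 - q ^ (5 * k + 3))) * (∏ k ∈ Finset.range n, (1 - q ^ (5 * k + 2))) *
      qFactorial (q ^ 5) n = ∑ᶠ j : ℤ, thetaTerm q j := by
  have hq5 : (q ^ 5) ^ (m + 1) = 0 := by rw [← pow_mul]; exact pow_eq_zero_of_le (by lia) hq
  rw [prod_eq_finsum, finsum_mul' _ _ (hasFiniteSupport_tripleProduct q _ _),
    qFactorial_eq_of_le hq5 (by lia)]
  refine finsum_congr fun j ↦ ?_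
  rcases lt_or_ge (m : ℤ) |j| with hj | hj
  · simp [thetaTerm_eq_zero hq hj]
  · rw [abs_le] at hj
    rw [mul_assoc, gaussBinom_mul_qFactorial_eq_one hq5 (by lia) (by push_cast; lia), mul_one]

omit hq in
theorem qFactorial_five_mul (n : ℕ) :
    qFactorial q (5 * n) = (∏ k ∈ Finset.range n, (1 - q ^ (5 * k + 1)) * (1 - q ^ (5 * k + 4))) *
      ((∏ k ∈ Finset.range n, (1 - q ^ (5 * k + 3))) *
        (∏ k ∈ Finset.range n, (1 - q ^ (5 * k + 2))) * qFactorial (q ^ 5) n) := by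
  induction n with
  | zero => simp [qFactorial]
  | succ n ih =>
    rw [show 5 * (n + 1) = 5 * n + 1 + 1 + 1 + 1 + 1 by ring]
    simp only [qFactorial_succ, Finset.prod_range_succ, ih]
    ring

/-- The first Rogers-Ramanujan identity, truncated at order `m`. -/
theorem schurPoly_mul_prod_eq_one {n N : ℕ} (hn : 7 * m + 2 ≤ n) (hN : 2 * m ≤ N) :
    schurPoly q n * ∏ k ∈ Finset.range N, (1 - q ^ (5 * k + 1)) * (1 - q ^ (5 * k + 4)) = 1 := by
  have h := schurPoly_mul_qFactorial hq hn
  have hu := isUnit_qFactorial hq (5 * N)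
  rw [← qFactorial_eq_of_le hq (by lia : m ≤ 5 * N), ← prod_mul_qFactorial hq hN,
    qFactorial_five_mul, ← mul_assoc] at h
  rw [qFactorial_five_mul] at hu
  exact (isUnit_of_mul_isUnit_right hu).mul_eq_right.1 h

end Nilpotent

section GeneratingFunction

open PowerSeries

open scoped Classical in
/-- The generating function of the partitions whose multiset of parts satisfies `P`. -/
noncomputable def partitionSeries (P : Multiset ℕ → Prop) : ℤ⟦X⟧ :=
  PowerSeries.mk fun n ↦ ((Finset.univ.filter fun p : n.Partition ↦ P p.parts).card : ℤ)

theorem coeff_partitionSeries (P : Multiset ℕ → Prop) (n : ℕ)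
    [DecidablePred fun p : n.Partition ↦ P p.parts] :
    coeff n (partitionSeries P) =
      ((Finset.univ.filter fun p : n.Partition ↦ P p.parts).card : ℤ) := by
  rw [partitionSeries, coeff_mk]
  congr

theorem coeff_partitionSeries_congr {P Q : Multiset ℕ → Prop} {n : ℕ}
    (h : ∀ p : n.Partition, P p.parts ↔ Q p.parts) :
    coeff n (partitionSeries P) = coeff n (partitionSeries Q) := by
  classical
  rw [coeff_partitionSeries, coeff_partitionSeries, Finset.filter_congr fun p _ ↦ h p]

theorem partitionSeries_congr {P Q : Multiset ℕ → Prop}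
    (h : ∀ s : Multiset ℕ, (∀ i ∈ s, 0 < i) → (P s ↔ Q s)) :
    partitionSeries P = partitionSeries Q := by
  ext n
  exact coeff_partitionSeries_congr fun p ↦ h _ fun _ hi ↦ p.parts_pos hi

/-- Partitions either avoid the part `a` or arise by adding a part `a`. -/
theorem partitionSeries_eq_add (P : Multiset ℕ → Prop) {a : ℕ} (ha : 0 < a) :
    partitionSeries P = partitionSeries (fun s ↦ P s ∧ a ∉ s) +
      X ^ a * partitionSeries fun s ↦ P (a ::ₘ s) := by
  classical
  ext n
  rw [map_add, coeff_X_pow_mul']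
  simp only [coeff_partitionSeries]
  rw [← Finset.card_filter_add_card_filter_not (fun p : n.Partition ↦ a ∉ p.parts),
    Finset.filter_filter, Finset.filter_filter, Nat.cast_add]
  refine congrArg₂ _ (by congr) ?_
  split_ifs with h
  · rw [Nat.cast_inj]
    let e := Nat.Partition.partitionWithPartEquiv ha h
    symm
    refine Finset.card_bij (fun p _ ↦ (e.symm p).1) ?_ ?_ ?_
    · intro p hp
      simp only [Finset.mem_filter, Finset.mem_univ, true_and] at hp ⊢
      exact ⟨by simpa [e] using hp, by simp [e]⟩
    · intro p _ p' _ h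
      exact e.symm.injective (Subtype.ext h)
    · intro p hp
      simp only [Finset.mem_filter, Finset.mem_univ, true_and, not_not] at hp
      refine ⟨e ⟨p, hp.2⟩, ?_, by simp⟩
      simp only [Finset.mem_filter, Finset.mem_univ, true_and, e,
        Nat.Partition.partitionWithPartEquiv_apply_parts, Multiset.cons_erase hp.2, hp.1]
  · rw [Nat.cast_eq_zero, Finset.card_eq_zero, Finset.filter_eq_empty_iff]
    rintro p - ⟨-, hp⟩
    exact h (Nat.Partition.le_of_mem_parts (not_not.1 hp))

theorem coeff_partitionSeries_eq_ite {P : Multiset ℕ → Prop} (h₀ : P 0) {n : ℕ}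
    (hP : ∀ s, P s → ∀ i ∈ s, n < i) :
    coeff n (partitionSeries P) = coeff n 1 := by
  classical
  rw [coeff_partitionSeries, coeff_one]
  split_ifs with hn
  · subst hn
    simp [h₀]
  · rw [Nat.cast_eq_zero, Finset.card_eq_zero, Finset.filter_eq_empty_iff]
    intro p _ hp
    refine hn ?_
    rw [← p.parts_sum, Multiset.sum_eq_zero_iff]
    intro i hi
    have := hP _ hp i hi
    have := Nat.Partition.le_of_mem_parts hi
    lia

theorem partitionSeries_mul_one_sub {P : ℕ → Prop} {a : ℕ} (ha : 0 < a) (hP : P a) :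
    partitionSeries (fun s ↦ ∀ i ∈ s, P i) * (1 - X ^ a) =
      partitionSeries fun s ↦ ∀ i ∈ s, P i ∧ i ≠ a := by
  have h := partitionSeries_eq_add (fun s ↦ ∀ i ∈ s, P i) ha
  have h₁ : (fun s : Multiset ℕ ↦ ∀ i ∈ a ::ₘ s, P i) = fun s ↦ ∀ i ∈ s, P i := by
    ext s
    simp [hP]
  have h₂ : (fun s : Multiset ℕ ↦ (∀ i ∈ s, P i) ∧ a ∉ s) = fun s ↦ ∀ i ∈ s, P i ∧ i ≠ a := by
    ext s
    grind
  rw [h₁, h₂] at h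
  linear_combination h

theorem partitionSeries_mul_prod (N : ℕ) :
    partitionSeries (fun s ↦ ∀ j ∈ s, j % 5 = 1 ∨ j % 5 = 4) *
      ∏ k ∈ Finset.range N, (1 - X ^ (5 * k + 1)) * (1 - X ^ (5 * k + 4)) =
      partitionSeries fun s ↦ ∀ j ∈ s, (j % 5 = 1 ∨ j % 5 = 4) ∧ 5 * N < j := by
  induction N with
  | zero =>
    rw [Finset.prod_range_zero, mul_one]
    refine partitionSeries_congr fun s hs ↦ forall₂_congr fun i hi ↦ ?_
    simp [hs i hi]
  | succ N ih =>
    rw [Finset.prod_range_succ, ← mul_assoc, ih, ← mul_assoc,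
      partitionSeries_mul_one_sub (by lia) (by lia), partitionSeries_mul_one_sub (by lia) (by lia)]
    refine partitionSeries_congr fun s hs ↦ forall₂_congr fun i hi ↦ ?_
    lia

/-- Multisets with no two entries (at distinct positions) differing by less than `2`. -/
def IsSparse (s : Multiset ℕ) : Prop := ∀ j : ℕ, s.count j + s.count (j + 1) ≤ 1

theorem isSparse_cons_iff (n : ℕ) (s : Multiset ℕ) :
    (IsSparse ((n + 1) ::ₘ s) ∧ ∀ i ∈ (n + 1) ::ₘ s, i < n + 2) ↔
      IsSparse s ∧ ∀ i ∈ s, i < n := by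
  simp only [IsSparse, Multiset.mem_cons, forall_eq_or_imp, Multiset.count_cons]
  constructor
  · rintro ⟨h, -, hlt⟩
    refine ⟨fun j ↦ ?_, fun i hi ↦ ?_⟩
    · have := h j
      lia
    · have h₁ := h n
      have h₂ := h (n + 1)
      have h₃ := Multiset.one_le_count_iff_mem.2 hi
      have h₄ := hlt i hi
      by_contra h₅
      obtain rfl | rfl : i = n ∨ i = n + 1 := by lia
      · simp at h₁
        lia
      · simp at h₁
        lia
  · rintro ⟨h, hlt⟩
    refine ⟨fun j ↦ ?_, by lia, fun i hi ↦ (hlt i hi).trans (by lia)⟩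
    have h₀ (i : ℕ) (hi : n ≤ i) : s.count i = 0 :=
      Multiset.count_eq_zero.2 fun h ↦ (hlt i h).not_ge hi
    have := h j
    rcases lt_trichotomy j n with hj | rfl | hj
    · split_ifs <;> lia
    · simp [h₀]
    · rw [h₀ j hj.le, h₀ (j + 1) (by lia)]
      split_ifs <;> lia

theorem partitionSeries_isSparse (n : ℕ) :
    partitionSeries (fun s ↦ IsSparse s ∧ ∀ i ∈ s, i < n) = schurPoly X n := by
  have base (n : ℕ) (hn : n ≤ 1) :
      partitionSeries (fun s ↦ IsSparse s ∧ ∀ i ∈ s, i < n) = 1 := by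
    ext k
    rw [← coeff_partitionSeries_eq_ite (P := fun s ↦ s = 0) rfl (n := k) (by simp)]
    refine coeff_partitionSeries_congr fun p ↦ ⟨fun h ↦ ?_, fun h ↦ by simp [h, IsSparse]⟩
    refine Multiset.eq_zero_of_forall_notMem fun i hi ↦ ?_
    have := h.2 i hi
    have := p.parts_pos hi
    lia
  induction n using Nat.twoStepInduction with
  | zero => exact base 0 (by lia)
  | one => exact base 1 le_rfl
  | more n h₀ h₁ =>
    rw [schurPoly, ← h₀, ← h₁, partitionSeries_eq_add _ n.succ_pos]
    simp only [Nat.succ_eq_add_one, isSparse_cons_iff]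
    congr 1
    refine partitionSeries_congr fun s _ ↦ ?_
    rw [and_assoc]
    refine and_congr_right fun _ ↦ ⟨fun h i hi ↦ ?_, fun h ↦ ⟨fun i hi ↦ ?_, fun hi ↦ ?_⟩⟩
    · have := h.1 i hi
      have : i ≠ n + 1 := fun e ↦ h.2 (e ▸ hi)
      lia
    · exact (h i hi).trans (by lia)
    · exact (h _ hi).false

theorem coeff_partitionSeries_eq (m : ℕ) :
    coeff m (partitionSeries fun s ↦ ∀ j ∈ s, j % 5 = 1 ∨ j % 5 = 4) =
      coeff m (partitionSeries IsSparse) := by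
  let I := Ideal.span {(X : ℤ⟦X⟧) ^ (m + 1)}
  let f := Ideal.Quotient.mk I
  have hf (g g' : ℤ⟦X⟧) : f g = f g' ↔ ∀ k ≤ m, coeff k g = coeff k g' := by
    rw [Ideal.Quotient.eq, Ideal.mem_span_singleton, X_pow_dvd_iff]
    simp only [map_sub, sub_eq_zero, Nat.lt_succ_iff]
  have hq : f X ^ (m + 1) = 0 := by
    rw [← map_pow]
    exact Ideal.Quotient.eq_zero_iff_mem.2 (Ideal.mem_span_singleton_self _)
  have h₁ := schurPoly_mul_prod_eq_one hq (n := 7 * m + 2) le_rfl (N := 2 * m) le_rfl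
  have h₂ := congrArg f (partitionSeries_mul_prod (2 * m))
  have h₃ : f (partitionSeries fun s ↦ ∀ j ∈ s, (j % 5 = 1 ∨ j % 5 = 4) ∧ 5 * (2 * m) < j) =
      f 1 := by
    rw [hf]
    intro k hk
    refine coeff_partitionSeries_eq_ite (by simp) fun s hs i hi ↦ ?_
    have := (hs i hi).2
    lia
  rw [h₃, map_one, map_mul] at h₂
  simp only [map_prod, map_mul, map_sub, map_one, map_pow] at h₂
  rw [mul_comm] at h₁
  have h₄ := left_inv_eq_right_inv h₂ h₁
  rw [← map_schurPoly, ← partitionSeries_isSparse, hf] at h₄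
  rw [h₄ m le_rfl]
  refine coeff_partitionSeries_congr fun p ↦ and_iff_left fun i hi ↦ ?_
  have := Nat.Partition.le_of_mem_parts hi
  lia

end GeneratingFunction

end RogersRamanujan

open scoped Classical in
theorem rogers_ramanujan_first (m : ℕ) (hm : 1 ≤ m) :
    (Finset.univ.filter fun p : Nat.Partition m =>
        ∀ j ∈ p.parts, j % 5 = 1 ∨ j % 5 = 4).card =
    (Finset.univ.filter fun p : Nat.Partition m =>
        ∀ j : ℕ, p.parts.count j + p.parts.count (j + 1) ≤ 1).card := by
  have h := RogersRamanujan.coeff_partitionSeries_eq m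
  rw [RogersRamanujan.coeff_partitionSeries, RogersRamanujan.coeff_partitionSeries,
    Nat.cast_inj] at h
  convert h
  exact Iff.rfl
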